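/- Let p < π², k ∈ ℝ, define C(p) = 1 if p ≤ 0 and C(p) = 1 − p/π² if 0 < p < π², and set ε = min{π⁴·C(p), 1}. Then for every u ∈ C²([0,1]) with u(0) = u(1) = 0 and every v ∈ L²(0,1), the functional Φ(u,v) = ‖u''‖² − p‖u'‖² + ‖v‖² + ½(‖u'‖²)² + ε⟨u,v⟩ + k²‖u⁺‖² satisfies the lower bound Φ(u,v) ≥ (ε/(2π⁴))·(‖u''‖² + ‖v‖²). -/

import Mathlib

open Real MeasureTheory

noncomputable section

/-- The `L²(0,1)` inner product `⟨u,v⟩`. -/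
def ipL2 (u v : ℝ → ℝ) : ℝ := ∫ x in (0:ℝ)..1, u x * v x

/-- The squared `L²(0,1)` norm `‖u‖²`. -/
def nsqL2 (u : ℝ → ℝ) : ℝ := ∫ x in (0:ℝ)..1, (u x) ^ 2

/-- The subcritical coercivity constant `C(p)`. -/
def Cp (p : ℝ) : ℝ := if p ≤ 0 then 1 else 1 - p / π ^ 2

open Filter Topology in
/-- If `f` and `s` both vanish at `a`, and `s` has nonzero derivative there, then `f ^ 2 / s`
extends continuously by zero to `a`. -/
theorem tendsto_sq_div_of_hasDerivAt {f s : ℝ → ℝ} {f' s' a : ℝ} (hf : HasDerivAt f f' a)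
    (hs : HasDerivAt s s' a) (hfa : f a = 0) (hsa : s a = 0) (hs' : s' ≠ 0) :
    Tendsto (fun x => f x ^ 2 / s x) (𝓝 a) (𝓝 0) := by
  have hO : f =O[𝓝 a] s := by
    have hpair : Tendsto (fun x => (x, a)) (𝓝 a) (𝓝 a ×ˢ pure a) :=
      tendsto_id.prodMk (tendsto_pure.2 (Eventually.of_forall fun _ => rfl))
    have h := (HasDerivAtFilter.isTheta_sub hs hs').isBigO_symm.comp_tendsto hpair
    simpa [Function.comp_def, hfa, hsa] using hf.differentiableAt.isBigO_sub.trans h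
  obtain ⟨c, hc⟩ := hO.bound
  have hlim : Tendsto (fun x => c * |f x|) (𝓝 a) (𝓝 0) := by
    have := (hf.continuousAt.tendsto.abs).const_mul c
    simpa [hfa] using this
  refine squeeze_zero_norm' ?_ hlim
  filter_upwards [hc] with x hx
  rw [Real.norm_eq_abs, Real.norm_eq_abs] at hx
  rw [Real.norm_eq_abs, abs_div, abs_pow]
  rcases (abs_nonneg (s x)).eq_or_lt with h | h
  · have hfx : |f x| = 0 := le_antisymm (by simpa [← h] using hx) (abs_nonneg _)
    simp [hfx]
  · rw [div_le_iff₀ h]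
    nlinarith [abs_nonneg (f x)]

/-- **Wirtinger's inequality** on `(0,1)` with Dirichlet boundary conditions. -/
theorem pi_sq_mul_nsqL2_le {u : ℝ → ℝ} (hu : ContDiff ℝ 1 u) (h0 : u 0 = 0) (h1 : u 1 = 0) :
    π ^ 2 * nsqL2 u ≤ nsqL2 (deriv u) := by
  have hd (x : ℝ) : HasDerivAt u (deriv u x) x :=
    (hu.differentiable one_ne_zero x).hasDerivAt
  have hc : Continuous u := hu.continuous
  have hc' : Continuous (deriv u) := hu.continuous_deriv le_rfl
  have hlin (x : ℝ) : HasDerivAt (fun y => π * y) π x := by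
    simpa using (hasDerivAt_id x).const_mul π
  have hsin (x : ℝ) : HasDerivAt (fun y => sin (π * y)) (cos (π * x) * π) x := (hlin x).sin
  have hcos (x : ℝ) : HasDerivAt (fun y => cos (π * y)) (-sin (π * x) * π) x := (hlin x).cos
  set g : ℝ → ℝ := fun x => π * cos (π * x) * (u x ^ 2 / sin (π * x)) with hg
  have hpos {x : ℝ} (hx : x ∈ Set.Ioo (0 : ℝ) 1) : 0 < sin (π * x) :=
    sin_pos_of_pos_of_lt_pi (mul_pos pi_pos hx.1) (by nlinarith [pi_pos, hx.2])
  have hgd {x : ℝ} (hx : x ∈ Set.Ioo (0 : ℝ) 1) : HasDerivAt g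
      (deriv u x ^ 2 - π ^ 2 * u x ^ 2
        - (deriv u x - π * cos (π * x) / sin (π * x) * u x) ^ 2) x := by
    have hne := (hpos hx).ne'
    have h := ((hcos x).const_mul π).mul (((hd x).pow 2).div (hsin x) hne)
    refine h.congr_deriv ?_
    simp only [Pi.pow_apply, Pi.div_apply]
    field_simp
    ring_nf
  have hend {a : ℝ} (hua : u a = 0) (hsa : sin (π * a) = 0) : ContinuousAt g a := by
    have hca : cos (π * a) ≠ 0 := fun h => by
      have := sin_sq_add_cos_sq (π * a)
      simp [h, hsa] at this
    have h := ((hcos a).continuousAt.tendsto.const_mul π).mul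
      (tendsto_sq_div_of_hasDerivAt (hd a) (hsin a) hua hsa (mul_ne_zero hca pi_ne_zero))
    simpa [ContinuousAt, hg, hua] using h
  have hgc : ContinuousOn g (Set.Icc 0 1) := by
    intro x hx
    refine ContinuousAt.continuousWithinAt ?_
    rcases hx.1.eq_or_lt with rfl | hx0
    · exact hend h0 (by simp)
    rcases hx.2.eq_or_lt with rfl | hx1
    · exact hend h1 (by simp)
    exact (hgd ⟨hx0, hx1⟩).continuousAt
  have key := intervalIntegral.sub_le_integral_of_hasDeriv_right_of_le
    (φ := fun x => deriv u x ^ 2 - π ^ 2 * u x ^ 2) zero_le_one hgc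
    (fun x hx => (hgd hx).hasDerivWithinAt)
    (Continuous.integrableOn_Icc (by fun_prop)) (fun x _ => sub_le_self _ (sq_nonneg _))
  rw [intervalIntegral.integral_sub (Continuous.intervalIntegrable (by fun_prop) _ _)
    (Continuous.intervalIntegrable (by fun_prop) _ _),
    intervalIntegral.integral_const_mul] at key
  simp only [hg, h0, h1] at key
  simp only [nsqL2]
  norm_num at key
  exact key

/-- The squared norm is nonnegative. -/
theorem nsqL2_nonneg (u : ℝ → ℝ) : 0 ≤ nsqL2 u :=
  intervalIntegral.integral_nonneg zero_le_one fun _ _ => sq_nonneg _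

/-- Integration by parts for functions vanishing at the endpoints. -/
theorem ipL2_deriv_deriv {u : ℝ → ℝ} (hu : ContDiff ℝ 2 u) (h0 : u 0 = 0) (h1 : u 1 = 0) :
    ipL2 u (deriv (deriv u)) = -nsqL2 (deriv u) := by
  have hu' : ContDiff ℝ 1 (deriv u) := hu.deriv'
  have h := intervalIntegral.integral_mul_deriv_eq_deriv_mul (a := 0) (b := 1)
    (fun x _ => (hu.differentiable two_ne_zero x).hasDerivAt)
    (fun x _ => (hu'.differentiable one_ne_zero x).hasDerivAt)
    (hu'.continuous.intervalIntegrable _ _)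
    ((hu'.continuous_deriv le_rfl).intervalIntegrable _ _)
  simpa [ipL2, nsqL2, h0, h1, sq] using h

/-- The pinned-boundary inequality `π² ‖u'‖² ≤ ‖u''‖²`. -/
theorem pi_sq_mul_nsqL2_deriv_le {u : ℝ → ℝ} (hu : ContDiff ℝ 2 u) (h0 : u 0 = 0)
    (h1 : u 1 = 0) : π ^ 2 * nsqL2 (deriv u) ≤ nsqL2 (deriv (deriv u)) := by
  have hc : Continuous u := hu.continuous
  have hc'' : Continuous (deriv (deriv u)) := hu.deriv'.continuous_deriv le_rfl
  have hw := pi_sq_mul_nsqL2_le (hu.of_le one_le_two) h0 h1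
  have hexp : nsqL2 (fun x => deriv (deriv u) x + π ^ 2 * u x)
      = nsqL2 (deriv (deriv u)) + 2 * π ^ 2 * ipL2 u (deriv (deriv u)) + π ^ 4 * nsqL2 u := by
    simp only [nsqL2, ipL2]
    rw [← intervalIntegral.integral_const_mul, ← intervalIntegral.integral_const_mul,
      ← intervalIntegral.integral_add, ← intervalIntegral.integral_add]
    · congr 1 with x
      ring
    all_goals exact Continuous.intervalIntegrable (by fun_prop) _ _
  have hnn := nsqL2_nonneg (fun x => deriv (deriv u) x + π ^ 2 * u x)
  rw [hexp, ipL2_deriv_deriv hu h0 h1] at hnn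
  nlinarith [mul_le_mul_of_nonneg_left hw (sq_nonneg π)]

/-- Young's inequality for the `L²` pairing. -/
theorem neg_half_add_le_ipL2 {u v : ℝ → ℝ} (hu : Continuous u) (hvm : Measurable v)
    (hv2 : IntervalIntegrable (fun x => (v x) ^ 2) volume 0 1) :
    -((nsqL2 u + nsqL2 v) / 2) ≤ ipL2 u v := by
  have hu2 : IntervalIntegrable (fun x => u x ^ 2) volume 0 1 :=
    (hu.pow 2).intervalIntegrable _ _
  have huv : IntervalIntegrable (fun x => u x * v x) volume 0 1 := by
    refine (hu2.add hv2).mono_fun (hu.measurable.mul hvm).aestronglyMeasurable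
      (Filter.Eventually.of_forall fun x => ?_)
    simp only [Real.norm_eq_abs]
    rw [abs_of_nonneg (by positivity : 0 ≤ u x ^ 2 + v x ^ 2), abs_le]
    constructor <;> nlinarith [sq_nonneg (u x + v x), sq_nonneg (u x - v x)]
  have hnn := nsqL2_nonneg (fun x => u x + v x)
  have hexp : nsqL2 (fun x => u x + v x) = nsqL2 u + nsqL2 v + 2 * ipL2 u v := by
    simp only [nsqL2, ipL2]
    rw [← intervalIntegral.integral_const_mul, ← intervalIntegral.integral_add hu2 hv2,
      ← intervalIntegral.integral_add (hu2.add hv2) (huv.const_mul 2)]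
    congr 1 with x
    ring
  linarith

/-- Lower bound for the perturbed energy functional used in the proof of exponential
stability: for `p < π²`, `ε = min{π⁴C(p), 1}`, `u ∈ C²([0,1])` with `u(0) = u(1) = 0`
and `v ∈ L²(0,1)`,
`Φ(u,v) = ‖u''‖² − p‖u'‖² + ‖v‖² + ½(‖u'‖²)² + ε⟨u,v⟩ + k²‖u⁺‖²
  ≥ (ε/(2π⁴))(‖u''‖² + ‖v‖²)`. -/
theorem phi_lower_bound (p k : ℝ) (hp : p < π ^ 2) (u v : ℝ → ℝ)
    (hu : ContDiff ℝ 2 u) (h0 : u 0 = 0) (h1 : u 1 = 0)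
    (hvm : Measurable v) (hv2 : IntervalIntegrable (fun x => (v x) ^ 2) volume 0 1) :
    nsqL2 (deriv (deriv u)) - p * nsqL2 (deriv u) + nsqL2 v
        + (1 / 2) * (nsqL2 (deriv u)) ^ 2
        + min (π ^ 4 * Cp p) 1 * ipL2 u v
        + k ^ 2 * nsqL2 (fun x => max (u x) 0)
      ≥ (min (π ^ 4 * Cp p) 1 / (2 * π ^ 4))
          * (nsqL2 (deriv (deriv u)) + nsqL2 v) := by
  have hπ : 0 < π ^ 2 := by positivity
  have hπ4 : 1 ≤ π ^ 4 := one_le_pow₀ (by linarith [pi_gt_three])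
  have hw := pi_sq_mul_nsqL2_le (hu.of_le one_le_two) h0 h1
  have hw' := pi_sq_mul_nsqL2_deriv_le hu h0 h1
  have hy := neg_half_add_le_ipL2 hu.continuous hvm hv2
  have hA := nsqL2_nonneg (deriv (deriv u))
  have hB := nsqL2_nonneg (deriv u)
  have hN := nsqL2_nonneg v
  have hplus := mul_nonneg (sq_nonneg k) (nsqL2_nonneg (fun x => max (u x) 0))
  have hC : 0 < Cp p := by
    unfold Cp
    split_ifs
    · exact one_pos
    · rwa [sub_pos, div_lt_one hπ]
  have hCA : Cp p * nsqL2 (deriv (deriv u))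
      ≤ nsqL2 (deriv (deriv u)) - p * nsqL2 (deriv u) := by
    unfold Cp
    split_ifs with h
    · nlinarith
    · have hdiv : nsqL2 (deriv u) ≤ nsqL2 (deriv (deriv u)) / π ^ 2 := by
        rw [le_div_iff₀ hπ]; linarith
      have := mul_le_mul_of_nonneg_left hdiv (not_le.mp h).le
      calc _ = nsqL2 (deriv (deriv u)) - p * (nsqL2 (deriv (deriv u)) / π ^ 2) := by ring
        _ ≤ _ := by linarith
  have hε0 : 0 < min (π ^ 4 * Cp p) 1 := lt_min (by positivity) one_pos
  have hε1 : min (π ^ 4 * Cp p) 1 ≤ 1 := min_le_right _ _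
  have hεC : min (π ^ 4 * Cp p) 1 / π ^ 4 ≤ Cp p := by
    rw [div_le_iff₀ (by positivity), mul_comm (Cp p)]
    exact min_le_left _ _
  have hD : nsqL2 u ≤ nsqL2 (deriv (deriv u)) / π ^ 4 := by
    rw [le_div_iff₀ (by positivity)]
    nlinarith [mul_le_mul_of_nonneg_left hw hπ.le]
  generalize min (π ^ 4 * Cp p) 1 = ε at *
  have hεA := mul_le_mul_of_nonneg_right hεC hA
  have hεy := mul_le_mul_of_nonneg_left hy hε0.le
  have hεD := mul_le_mul_of_nonneg_left hD hε0.le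
  have hεN : ε * nsqL2 v ≤ nsqL2 v := mul_le_of_le_one_left hN hε1
  have hεN' : ε / π ^ 4 * nsqL2 v ≤ nsqL2 v :=
    mul_le_of_le_one_left hN (div_le_one_of_le₀ (hε1.trans hπ4) (by positivity))
  have hhalf : ε / (2 * π ^ 4) = ε / π ^ 4 / 2 := by ring
  have hcomm : ε * (nsqL2 (deriv (deriv u)) / π ^ 4)
      = ε / π ^ 4 * nsqL2 (deriv (deriv u)) := by ring
  rw [hhalf]
  nlinarith [sq_nonneg (nsqL2 (deriv u))]
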